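/- Let n ≥ 1 and let m be a nonnegative integer. Then, as an identity of rational functions in ℚ(x_1^{1/2},…,x_n^{1/2}), the Schur polynomial s_{(m^n)} in the 2n variables (x_1, x_1^{−1}, …, x_{n−1}, x_{n−1}^{−1}, x_n, 1) equals so^B_{((m/2)^n)}(x_1,…,x_n) · sp_{((m/2)^{n−1})}(x_1,…,x_{n−1}) · x_n^{m/2}. -/

import Mathlib

open Matrix BigOperators
open scoped Classical

noncomputable section

/-- The field `ℚ(t_1, …, t_n)` of rational functions in `n` indeterminates over `ℚ`. -/
abbrev FF (n : ℕ) : Type := FractionRing (MvPolynomial (Fin n) ℚ)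

/-- The `i`-th indeterminate, viewed as an element of `FF n`. -/
def gen (n : ℕ) (i : Fin n) : FF n :=
  algebraMap (MvPolynomial (Fin n) ℚ) (FF n) (MvPolynomial.X i)

variable {F : Type*} [Field F]

/-- Symplectic character `sp_λ(x_1, …, x_N)`, in "doubled" form: `z i` represents
`x_i^{1/2}` and `μ i` represents `2·λ_i` (so half-integer weights are allowed). -/
def spD {N : ℕ} (z : Fin N → F) (μ : Fin N → ℤ) : F :=
  Matrix.det (Matrix.of fun i j : Fin N =>
      z j ^ (μ i + 2 * ((N : ℤ) - (i : ℕ))) - z j ^ (-(μ i + 2 * ((N : ℤ) - (i : ℕ))))) /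
  Matrix.det (Matrix.of fun i j : Fin N =>
      z j ^ (2 * ((N : ℤ) - (i : ℕ))) - z j ^ (-(2 * ((N : ℤ) - (i : ℕ)))))

/-- Odd orthogonal character `so^B_λ(x_1, …, x_N)`, in "doubled" form: `z i` represents
`x_i^{1/2}` and `μ i` represents `2·λ_i`. -/
def soBD {N : ℕ} (z : Fin N → F) (μ : Fin N → ℤ) : F :=
  Matrix.det (Matrix.of fun i j : Fin N =>
      z j ^ (μ i + 2 * ((N : ℤ) - (i : ℕ)) - 1) -
        z j ^ (-(μ i + 2 * ((N : ℤ) - (i : ℕ)) - 1))) /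
  Matrix.det (Matrix.of fun i j : Fin N =>
      z j ^ (2 * ((N : ℤ) - (i : ℕ)) - 1) - z j ^ (-(2 * ((N : ℤ) - (i : ℕ)) - 1)))

/-- Even orthogonal character `so^D_λ(x_1, …, x_N)`, in "doubled" form: `z i` represents
`x_i^{1/2}` and `μ i` represents `2·λ_i`; the factor is `2` if `λ_N > 0` and `1` otherwise. -/
def soDD {N : ℕ} (z : Fin N → F) (μ : Fin N → ℤ) : F :=
  (if h : 0 < N then (if 0 < μ ⟨N - 1, Nat.sub_lt h Nat.one_pos⟩ then (2 : F) else 1) else 1) *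
  (Matrix.det (Matrix.of fun i j : Fin N =>
      z j ^ (μ i + 2 * ((N : ℤ) - 1 - (i : ℕ))) +
        z j ^ (-(μ i + 2 * ((N : ℤ) - 1 - (i : ℕ))))) /
   Matrix.det (Matrix.of fun i j : Fin N =>
      z j ^ (2 * ((N : ℤ) - 1 - (i : ℕ))) + z j ^ (-(2 * ((N : ℤ) - 1 - (i : ℕ))))))

/-- The matrix `Ā_λ` of the bialternant formula for the intermediate symplectic character
`sp^{(k, N-k)}`, in "doubled" form: `z i` represents `x_i^{1/2}`, `μ i` represents `2·λ_i`. -/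
def interMatD {N : ℕ} (k : ℕ) (z : Fin N → F) (μ : Fin N → ℤ) : Matrix (Fin N) (Fin N) F :=
  Matrix.of fun i j : Fin N =>
    if (j : ℕ) < k then
      z j ^ (μ i + 2 * ((k : ℤ) - (i : ℕ))) /
          ∏ l ∈ Finset.univ.filter (fun l : Fin N => k ≤ (l : ℕ)), (1 - (z j ^ 2)⁻¹ * z l ^ 2) -
        z j ^ (-(μ i + 2 * ((k : ℤ) - (i : ℕ)))) /
          ∏ l ∈ Finset.univ.filter (fun l : Fin N => k ≤ (l : ℕ)), (1 - z j ^ 2 * z l ^ 2)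
    else z j ^ (μ i + 2 * ((N : ℤ) - 1 - (i : ℕ)))

/-- Intermediate symplectic character `sp^{(k, N-k)}_λ(x_1, …, x_k | x_{k+1}, …, x_N)`, in
"doubled" form: `z i` represents `x_i^{1/2}` and `μ i` represents `2·λ_i`. -/
def spInterD {N : ℕ} (k : ℕ) (z : Fin N → F) (μ : Fin N → ℤ) : F :=
  (interMatD k z μ).det / (interMatD k z fun _ => 0).det

/-- Symplectic character `sp_λ(z_1, …, z_N)` for an integer weight `μ`. -/
def spP {N : ℕ} (z : Fin N → F) (μ : Fin N → ℤ) : F :=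
  Matrix.det (Matrix.of fun i j : Fin N =>
      z j ^ (μ i + (N : ℤ) - (i : ℕ)) - z j ^ (-(μ i + (N : ℤ) - (i : ℕ)))) /
  Matrix.det (Matrix.of fun i j : Fin N =>
      z j ^ ((N : ℤ) - (i : ℕ)) - z j ^ (-((N : ℤ) - (i : ℕ))))

/-- The matrix `Ā_λ` of the bialternant formula for the intermediate symplectic character
`sp^{(k, N-k)}` with integer weight `μ`. -/
def interMatP {N : ℕ} (k : ℕ) (z : Fin N → F) (μ : Fin N → ℤ) : Matrix (Fin N) (Fin N) F :=
  Matrix.of fun i j : Fin N =>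
    if (j : ℕ) < k then
      z j ^ (μ i + (k : ℤ) - (i : ℕ)) /
          ∏ l ∈ Finset.univ.filter (fun l : Fin N => k ≤ (l : ℕ)), (1 - (z j)⁻¹ * z l) -
        z j ^ (-(μ i + (k : ℤ) - (i : ℕ))) /
          ∏ l ∈ Finset.univ.filter (fun l : Fin N => k ≤ (l : ℕ)), (1 - z j * z l)
    else z j ^ (μ i + (N : ℤ) - 1 - (i : ℕ))

/-- Intermediate symplectic character `sp^{(k, N-k)}_μ(z_1, …, z_k | z_{k+1}, …, z_N)`
for an integer weight `μ`. -/
def spInterP {N : ℕ} (k : ℕ) (z : Fin N → F) (μ : Fin N → ℤ) : F :=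
  (interMatP k z μ).det / (interMatP k z fun _ => 0).det

/-- Schur function `s_μ(z_1, …, z_N)` as a ratio of alternants (bialternant formula). -/
def schurP {N : ℕ} (z : Fin N → F) (μ : Fin N → ℤ) : F :=
  Matrix.det (Matrix.of fun i j : Fin N => z j ^ (μ i + (N : ℤ) - 1 - (i : ℕ))) /
  Matrix.det (Matrix.of fun i j : Fin N => z j ^ ((N : ℤ) - 1 - (i : ℕ)))

/-- Splits the rows of a `2n × 2n` alternant into the first `n` rows and the last `n` rows, the
latter in reverse order. -/
def rowSplit (n : ℕ) : Fin n ⊕ Fin n ≃ Fin (2 * n) :=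
  Equiv.ofBijective
    (Sum.elim (fun i => ⟨i, by omega⟩) (fun i => ⟨2 * n - 1 - i, by omega⟩)) (by
      rw [Fintype.bijective_iff_injective_and_card]
      refine ⟨?_, by simp; omega⟩
      rintro (i | i) (j | j) h <;> simp [Fin.ext_iff] at h ⊢ <;> omega)

/-- Splits the columns of a `2n × 2n` alternant into those of even and those of odd index. -/
def colSplit (n : ℕ) : Fin n ⊕ Fin n ≃ Fin (2 * n) :=
  Equiv.ofBijective
    (Sum.elim (fun i => ⟨2 * i, by omega⟩) (fun i => ⟨2 * i + 1, by omega⟩)) (by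
      rw [Fintype.bijective_iff_injective_and_card]
      refine ⟨?_, by simp; omega⟩
      rintro (i | i) (j | j) h <;> simp [Fin.ext_iff] at h ⊢ <;> omega)

theorem det_submatrix_equiv_equiv {R m n : Type*} [CommRing R] [Fintype m] [DecidableEq m]
    [Fintype n] [DecidableEq n] (e₁ e₂ : m ≃ n) (A : Matrix n n R) :
    (A.submatrix e₁ e₂).det = Equiv.Perm.sign (e₁.symm.trans e₂) * A.det := by
  have h : A.submatrix e₁ e₂ = (A.submatrix id (e₁.symm.trans e₂)).submatrix e₁ e₁ := by
    ext i j
    simp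
  rw [h, det_submatrix_equiv_self, det_permute']

/-- A block determinant whose right-hand columns cancel, in the rows of differences, against
multiples of the left-hand columns. -/
theorem two_pow_mul_det_fromBlocks_of_sub_eq {n : Type*} [Fintype n] [DecidableEq n]
    (P P' Q Q' E : Matrix n n F) (h : Q - Q' = -((P - P') * E)) :
    2 ^ Fintype.card n * (fromBlocks P Q P' Q').det =
      (P - P').det * ((P + P') * E + (Q + Q')).det := by
  have hL : (fromBlocks 1 (-1) 1 1 : Matrix (n ⊕ n) (n ⊕ n) F).det = 2 ^ Fintype.card n := by
    rw [det_fromBlocks_one₁₁, one_mul, sub_neg_eq_add, one_add_one_eq_two]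
    have : (2 : Matrix n n F) = (2 : F) • 1 := by
      ext i j
      by_cases hij : i = j <;> simp [hij, Matrix.ofNat_apply]
    rw [this, det_smul, det_one, mul_one]
  have hR : (fromBlocks 1 E 0 1 : Matrix (n ⊕ n) (n ⊕ n) F).det = 1 := by
    simp
  rw [← hL, ← det_mul, ← mul_one (det _), ← hR, ← det_mul, fromBlocks_multiply,
    fromBlocks_multiply, ← det_fromBlocks_zero₁₂ (P - P') (P + P')]
  congr 2
  · simp [sub_eq_add_neg]
  · have : (P - P') * E + (Q - Q') = 0 := by rw [h, add_neg_cancel]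
    simpa [sub_eq_add_neg] using this
  · simp
  · simp

/-- Numerator of the odd orthogonal character of the rectangle `((m/2)^N)`. -/
def soNum {N : ℕ} (z : Fin N → F) (m : ℤ) : Matrix (Fin N) (Fin N) F :=
  Matrix.of fun i j : Fin N =>
      z j ^ (m + 2 * ((N : ℤ) - (i : ℕ)) - 1) - z j ^ (-(m + 2 * ((N : ℤ) - (i : ℕ)) - 1))

/-- Numerator of the symplectic character of the rectangle `((m/2)^N)`. -/
def spNum {N : ℕ} (z : Fin N → F) (m : ℤ) : Matrix (Fin N) (Fin N) F :=
  Matrix.of fun i j : Fin N =>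
      z j ^ (m + 2 * ((N : ℤ) - (i : ℕ))) - z j ^ (-(m + 2 * ((N : ℤ) - (i : ℕ))))

/-- The variables `(x_1, x_1⁻¹, …, x_{k}, x_{k}⁻¹, x_{k+1}, 1)`, with `x_i = t_i ^ 2`. -/
def pairedVars {k : ℕ} (t : Fin (k + 1) → F) (j : Fin (2 * (k + 1))) : F :=
  if (j : ℕ) = 2 * (k + 1) - 1 then 1
  else if (j : ℕ) % 2 = 0 then t ⟨(j : ℕ) / 2, by omega⟩ ^ 2
  else (t ⟨(j : ℕ) / 2, by omega⟩ ^ 2)⁻¹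

/-- Numerator of the Schur function of the rectangle `(m^{k+1})` in `2(k+1)` variables. -/
def schurNum {k : ℕ} (z : Fin (2 * (k + 1)) → F) (m : ℤ) :
    Matrix (Fin (2 * (k + 1))) (Fin (2 * (k + 1))) F :=
  Matrix.of fun i j => z j ^ ((if (i : ℕ) < k + 1 then m else 0) +
    ((2 * (k + 1) : ℕ) : ℤ) - 1 - (i : ℕ))

/-- The matrix `t_j^g + t_j^{-g}`, with all entries of the last column replaced by `1`. -/
def evenNum {k : ℕ} (t : Fin (k + 1) → F) (m : ℤ) : Matrix (Fin (k + 1)) (Fin (k + 1)) F :=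
  Matrix.of fun i j => if j = Fin.last k then 1 else
    t j ^ (m + 2 * ((k + 1 : ℤ) - (i : ℕ)) - 1) + t j ^ (-(m + 2 * ((k + 1 : ℤ) - (i : ℕ)) - 1))

theorem det_evenNum {k : ℕ} (t : Fin (k + 1) → F) (ht : ∀ j, t j ≠ 0) (m : ℤ) :
    (evenNum t m).det = (-1) ^ k * (∏ j : Fin k, ((t j.castSucc)⁻¹ - t j.castSucc)) *
      (spNum (fun j : Fin k => t j.castSucc) m).det := by
  let B : Matrix (Fin (k + 1)) (Fin (k + 1)) F := Matrix.of fun i j =>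
    Fin.cases (evenNum t m 0 j)
      (fun i' => evenNum t m i'.succ j - evenNum t m i'.castSucc j) i
  have hB : (evenNum t m).det = B.det :=
    det_eq_of_forall_row_eq_smul_add_pred (fun _ => 1) (fun j => by simp [B])
      (fun i j => by simp [B])
  have hcol : ∀ i : Fin k, B i.succ (Fin.last k) = 0 := fun i => by simp [B, evenNum]
  rw [hB, det_succ_column B (Fin.last k), Fin.sum_univ_succ,
    Finset.sum_eq_zero (fun i _ => by rw [hcol]; ring)]
  have h0 : B 0 (Fin.last k) = 1 := by simp [B, evenNum]
  have hsub : B.submatrix (Fin.succAbove 0) (Fin.succAbove (Fin.last k)) =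
      Matrix.of fun i j => ((t j.castSucc)⁻¹ - t j.castSucc) *
        spNum (fun j : Fin k => t j.castSucc) m i j := by
    ext i j
    have hj := ht j.castSucc
    simp only [B, evenNum, spNum, submatrix_apply, of_apply, Fin.succAbove_zero,
      Fin.succAbove_last, Fin.cases_succ, Fin.castSucc_ne_last, if_false, Fin.val_succ,
      Fin.val_castSucc]
    generalize t j.castSucc = x at hj
    obtain ⟨g, hg⟩ : ∃ g, g = m + 2 * ((k : ℤ) - (i : ℕ)) := ⟨_, rfl⟩
    rw [← hg, show m + 2 * ((k + 1 : ℤ) - ((i : ℕ) + 1 : ℕ)) - 1 = g - 1 by push_cast; omega,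
      show m + 2 * ((k + 1 : ℤ) - (i : ℕ)) - 1 = g + 1 by omega,
      show -(g - 1) = -g + 1 by ring, show -(g + 1) = -g - 1 by ring,
      zpow_add_one₀ hj, zpow_add_one₀ hj, zpow_sub_one₀ hj, zpow_sub_one₀ hj]
    ring
  rw [h0, hsub, det_mul_row]
  simp
  ring

/-- The inverses of the variables, with the last one replaced by `1`. -/
def invVars {k : ℕ} (t : Fin (k + 1) → F) (j : Fin (k + 1)) : F :=
  if j = Fin.last k then 1 else (t j)⁻¹

theorem det_schurNum_pairedVars {k : ℕ} (h2 : (2 : F) ≠ 0) (t : Fin (k + 1) → F)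
    (ht : ∀ j, t j ≠ 0) (m : ℤ) :
    (Equiv.Perm.sign ((rowSplit (k + 1)).symm.trans (colSplit (k + 1))) *
      (schurNum (pairedVars t) m).det) * t (Fin.last k) ^ (-(m + 2 * k + 1)) =
      (soNum t m).det * (evenNum t m).det := by
  obtain ⟨g, hg⟩ : ∃ g : Fin (k + 1) → ℤ,
      ∀ i, g i = m + 2 * ((k + 1 : ℕ) - (i : ℕ) : ℤ) - 1 := ⟨_, fun _ => rfl⟩
  let pw (z : Fin (k + 1) → F) (e : Fin (k + 1) → ℤ) : Matrix (Fin (k + 1)) (Fin (k + 1)) F :=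
    Matrix.of fun i j => z j ^ e i
  have hu : ∀ j, invVars t j ≠ 0 := fun j => by
    unfold invVars
    split_ifs
    · exact one_ne_zero
    · exact inv_ne_zero (ht j)
  have hinl : ∀ j, pairedVars t (colSplit (k + 1) (Sum.inl j)) = t j ^ 2 := fun j => by
    simp [pairedVars, colSplit]
    omega
  have hinr : ∀ j, pairedVars t (colSplit (k + 1) (Sum.inr j)) = invVars t j ^ 2 := fun j => by
    have h2 : (2 * (j : ℕ) + 1) / 2 = j := by omega
    have h3 : (2 * (j : ℕ) + 1) % 2 = 1 := by omega
    by_cases hj : j = Fin.last k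
    · subst hj
      have : 2 * k + 1 = 2 * (k + 1) - 1 := by omega
      simp [pairedVars, colSplit, invVars, this]
    · have h1 : 2 * (j : ℕ) + 1 ≠ 2 * (k + 1) - 1 := fun h => hj (Fin.ext (by simp; omega))
      simp [pairedVars, colSplit, invVars, hj, h1, h2, h3]
  let D : Fin (k + 1) ⊕ Fin (k + 1) → F :=
    Sum.elim (fun j => t j ^ (-(m + 2 * k + 1))) (fun j => invVars t j ^ (-(m + 2 * k + 1)))
  have hD : (∏ j, D j) = t (Fin.last k) ^ (-(m + 2 * k + 1)) := by
    rw [Fintype.prod_sum_type, ← Finset.prod_mul_distrib, Fin.prod_univ_castSucc]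
    have (j : Fin k) : D (Sum.inl j.castSucc) * D (Sum.inr j.castSucc) = 1 := by
      simp only [D, Sum.elim_inl, Sum.elim_inr, invVars, Fin.castSucc_ne_last, if_false]
      rw [← mul_zpow, mul_inv_cancel₀ (ht _), _root_.one_zpow]
    simp only [this]
    simp [D, invVars]
  have hentry (x : F) (hx : x ≠ 0) (i : Fin (k + 1)) :
      x ^ (-(m + 2 * k + 1)) * (x ^ 2) ^ (m + ((2 * (k + 1) : ℕ) : ℤ) - 1 - (i : ℕ)) = x ^ g i ∧
      x ^ (-(m + 2 * k + 1)) * (x ^ 2) ^ (((2 * (k + 1) : ℕ) : ℤ) - 1 -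
        ((2 * (k + 1) - 1 - i : ℕ) : ℤ)) = x ^ (-g i) := by
    rw [← zpow_natCast x 2, ← _root_.zpow_mul, ← _root_.zpow_mul, ← zpow_add₀ hx, ← zpow_add₀ hx, hg]
    constructor <;> congr 1 <;> push_cast <;> omega
  have hM : (Matrix.of fun i j =>
      D j * (schurNum (pairedVars t) m).submatrix (rowSplit (k + 1)) (colSplit (k + 1)) i j) =
      fromBlocks (pw t g) (pw (invVars t) g) (pw t (-g)) (pw (invVars t) (-g)) := by
    have h1 (i : Fin (k + 1)) : ((rowSplit (k + 1) (Sum.inl i) : Fin _) : ℕ) = i := rfl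
    have h2 (i : Fin (k + 1)) :
        ((rowSplit (k + 1) (Sum.inr i) : Fin _) : ℕ) = 2 * (k + 1) - 1 - i := rfl
    have h3 (i : Fin (k + 1)) : ¬ (2 * (k + 1) - 1 - i < k + 1) := by omega
    have h4 (i : Fin (k + 1)) : (i : ℕ) < k + 1 := i.isLt
    ext (i | i) (j | j)
    · simpa only [schurNum, hinl, h1, h4, pw, D, submatrix_apply, of_apply, if_true,
        Sum.elim_inl, fromBlocks_apply₁₁] using (hentry (t j) (ht j) i).1
    · simpa only [schurNum, hinr, h1, h4, pw, D, submatrix_apply, of_apply, if_true,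
        Sum.elim_inr, fromBlocks_apply₁₂] using (hentry _ (hu j) i).1
    · simpa only [schurNum, hinl, h2, h3, pw, D, submatrix_apply, of_apply, if_false, zero_add,
        Pi.neg_apply,
        Sum.elim_inl, fromBlocks_apply₂₁] using (hentry (t j) (ht j) i).2
    · simpa only [schurNum, hinr, h2, h3, pw, D, submatrix_apply, of_apply, if_false, zero_add,
        Pi.neg_apply,
        Sum.elim_inr, fromBlocks_apply₂₂] using (hentry _ (hu j) i).2
  have hdet := congrArg det hM
  rw [det_mul_row, hD, det_submatrix_equiv_equiv, mul_comm] at hdet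
  let E : Matrix (Fin (k + 1)) (Fin (k + 1)) F :=
    diagonal fun j => if j = Fin.last k then 0 else 1
  have hE : pw (invVars t) g - pw (invVars t) (-g) = -((pw t g - pw t (-g)) * E) := by
    ext i j
    by_cases hj : j = Fin.last k <;> simp [pw, E, invVars, hj]
  have hS : pw t g - pw t (-g) = soNum t m := by
    ext i j
    simp [pw, soNum, hg]
  have hC : (pw t g + pw t (-g)) * E + (pw (invVars t) g + pw (invVars t) (-g)) =
      (2 : F) • evenNum t m := by
    ext i j
    by_cases hj : j = Fin.last k
    · simp [pw, E, invVars, evenNum, hj, one_add_one_eq_two]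
    · simp [pw, E, invVars, evenNum, hj, hg]
      ring
  have key := two_pow_mul_det_fromBlocks_of_sub_eq _ _ _ _ E hE
  rw [← hdet, hC, hS, Fintype.card_fin, det_smul, Fintype.card_fin,
    mul_left_comm (soNum t m).det] at key
  exact mul_left_cancel₀ (pow_ne_zero _ h2) key

theorem exists_det_schurNum_pairedVars {k : ℕ} (h2 : (2 : F) ≠ 0) (t : Fin (k + 1) → F)
    (ht : ∀ j, t j ≠ 0) (ht' : ∀ j, t j ^ 2 ≠ 1) :
    ∃ c : F, c ≠ 0 ∧ ∀ m : ℤ, (schurNum (pairedVars t) m).det =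
      c * ((soNum t m).det * (spNum (fun j : Fin k => t j.castSucc) m).det *
        t (Fin.last k) ^ m) := by
  obtain ⟨s, hs⟩ : ∃ s, s = Equiv.Perm.sign ((rowSplit (k + 1)).symm.trans (colSplit (k + 1))) :=
    ⟨_, rfl⟩
  have hss : ((s : ℤ) : F) * ((s : ℤ) : F) = 1 := by
    rw [← Int.cast_mul, Int.units_coe_mul_self, Int.cast_one]
  refine ⟨(s : ℤ) * (-1) ^ k * (∏ j : Fin k, ((t j.castSucc)⁻¹ - t j.castSucc)) *
    t (Fin.last k) ^ (2 * k + 1 : ℤ), ?_, fun m => ?_⟩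
  · refine mul_ne_zero (mul_ne_zero (mul_ne_zero (left_ne_zero_of_mul_eq_one hss) ?_) ?_)
      (zpow_ne_zero _ (ht _))
    · exact pow_ne_zero _ (neg_ne_zero.mpr one_ne_zero)
    · refine Finset.prod_ne_zero_iff.mpr fun j _ h => ht' j.castSucc ?_
      rw [sq]
      nth_rewrite 1 [← sub_eq_zero.mp h]
      exact inv_mul_cancel₀ (ht _)
  · have key := det_schurNum_pairedVars h2 t ht m
    rw [← hs, det_evenNum t ht, _root_.zpow_neg, ← div_eq_mul_inv,
      div_eq_iff (zpow_ne_zero _ (ht _)), add_assoc, zpow_add₀ (ht _)] at key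
    rw [← one_mul (schurNum (pairedVars t) m).det, ← congrArg (· * _) hss, mul_assoc, key]
    ring

theorem algebraMap_FF_injective (n : ℕ) :
    Function.Injective (algebraMap (MvPolynomial (Fin n) ℚ) (FF n)) :=
  IsFractionRing.injective _ _

theorem gen_ne_zero (n : ℕ) (j : Fin n) : gen n j ≠ 0 := by
  rw [gen, Ne, map_eq_zero_iff _ (algebraMap_FF_injective n)]
  exact MvPolynomial.X_ne_zero j

theorem gen_sq_ne_one (n : ℕ) (j : Fin n) : gen n j ^ 2 ≠ 1 := by
  rw [gen, ← map_pow, ← map_one (algebraMap (MvPolynomial (Fin n) ℚ) (FF n)),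
    (algebraMap_FF_injective n).ne_iff]
  intro h
  simpa using congrArg (MvPolynomial.eval 0) h

theorem two_ne_zero_FF (n : ℕ) : (2 : FF n) ≠ 0 := by
  rw [← map_ofNat (algebraMap (MvPolynomial (Fin n) ℚ) (FF n)) 2, Ne,
    map_eq_zero_iff _ (algebraMap_FF_injective n)]
  exact two_ne_zero

/-- **Factorization.**  For `n ≥ 1` and a nonnegative integer `m`, the Schur function of shape
`(m^n)` in the `2n` variables `(x_1, x_1^{-1}, …, x_{n-1}, x_{n-1}^{-1}, x_n, 1)` equals
`so^B_{((m/2)^n)}(x_1,…,x_n) · sp_{((m/2)^{n-1})}(x_1,…,x_{n-1}) · x_n^{m/2}`, as an identity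
in `ℚ(x_1^{1/2}, …, x_n^{1/2})`.  Here `gen n i` plays the role of `x_i^{1/2}` (so
`x_i = (gen n i)^2`), and the weights of `soBD` and `spD` are doubled. -/
theorem schur_rectangle_factor_soB_sp' (n m : ℕ) (hn : 1 ≤ n) :
    schurP
      (fun j : Fin (2 * n) =>
        if h : (j : ℕ) = 2 * n - 1 then (1 : FF n)
        else if (j : ℕ) % 2 = 0 then gen n ⟨(j : ℕ) / 2, by have := j.isLt; omega⟩ ^ 2
        else (gen n ⟨(j : ℕ) / 2, by have := j.isLt; omega⟩ ^ 2)⁻¹)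
      (fun j => if (j : ℕ) < n then (m : ℤ) else 0) =
    soBD (gen n) (fun _ => (m : ℤ)) *
      spD (fun i : Fin (n - 1) => gen n ⟨(i : ℕ), by have := i.isLt; omega⟩)
        (fun _ => (m : ℤ)) *
      gen n ⟨n - 1, by omega⟩ ^ (m : ℤ) := by
  obtain ⟨k, rfl⟩ : ∃ k, n = k + 1 := ⟨n - 1, by omega⟩
  obtain ⟨c, hc, h⟩ := exists_det_schurNum_pairedVars (two_ne_zero_FF (k + 1)) (gen (k + 1))
    (gen_ne_zero _) (gen_sq_ne_one _)
  have hschur : schurP (pairedVars (gen (k + 1)))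
      (fun j => if (j : ℕ) < k + 1 then (m : ℤ) else 0) =
      (schurNum (pairedVars (gen (k + 1))) m).det /
        (schurNum (pairedVars (gen (k + 1))) 0).det := by
    simp only [schurP, schurNum, ite_self, zero_add]
  have hso : soBD (gen (k + 1)) (fun _ => (m : ℤ)) =
      (soNum (gen (k + 1)) m).det / (soNum (gen (k + 1)) 0).det := by
    simp only [soBD, soNum, zero_add]
  have hsp : spD (fun j : Fin k => gen (k + 1) j.castSucc) (fun _ => (m : ℤ)) =
      (spNum (fun j : Fin k => gen (k + 1) j.castSucc) m).det /
        (spNum (fun j : Fin k => gen (k + 1) j.castSucc) 0).det := by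
    simp only [spD, spNum, zero_add]
  change schurP (pairedVars (gen (k + 1))) _ = soBD _ _ *
    spD (N := k) (fun j => gen (k + 1) j.castSucc) (fun _ => (m : ℤ)) *
      gen (k + 1) (Fin.last k) ^ (m : ℤ)
  rw [hschur, hso, hsp, h, h, mul_div_mul_left _ _ hc, _root_.zpow_zero, mul_one,
    div_mul_div_comm, div_mul_eq_mul_div]
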